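/- arXiv:2106.13796 — 3 statements merged into one kernel-verified Lean document; each statement's English description precedes it below -/
import Mathlib

section
/- Let a, b, c, n be positive integers with gcd(a,b) = gcd(b,c) = gcd(c,a) = 1, and let b'_1, c'_1, c'_2, a'_2, a'_3, b'_3 be defined as follows: b'_1 is the unique integer with 1 ≤ b'_1 ≤ a and b·b'_1 ≡ −n (mod a); c'_1 is the unique integer with 1 ≤ c'_1 ≤ a and c·c'_1 ≡ b (mod a); c'_2 is the unique integer with 1 ≤ c'_2 ≤ b and c·c'_2 ≡ −n (mod b); a'_2 is the unique integer with 1 ≤ a'_2 ≤ b and a·a'_2 ≡ c (mod b); a'_3 is the unique integer with 1 ≤ a'_3 ≤ c and a·a'_3 ≡ −n (mod c); b'_3 is the unique integer with 1 ≤ b'_3 ≤ c and b·b'_3 ≡ a (mod c). Then N(a,b,c;n) = n(n+a+b+c)/(2abc) − 1/2 + (b'_1/(2a) + c'_2/(2b) + a'_3/(2c)) − Σ_{i=1}^{b'_1−1} ((i·c'_1/a)) − Σ_{i=1}^{c'_2−1} ((i·a'_2/b)) − Σ_{i=1}^{a'_3−1} ((i·b'_3/c)). -/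
/-- `numSol a b c n` is the number of triples `(x, y, z)` of nonnegative integers
satisfying `a*x + b*y + c*z = n`. -/
noncomputable def numSol (a b c n : ℕ) : ℕ :=
  {p : ℕ × ℕ × ℕ | a * p.1 + b * p.2.1 + c * p.2.2 = n}.ncard

open Classical in
/-- The sawtooth function: `((x)) = {x} - 1/2` if `x` is not an integer, and `0` otherwise. -/
noncomputable def saw (x : ℚ) : ℚ :=
  if ∃ m : ℤ, (m : ℚ) = x then 0 else Int.fract x - 1 / 2

open Finset

/-- The fractional part of `x / q` for a residue class `x` modulo `q`. -/
noncomputable def residueFract {q : ℕ} (x : ZMod q) : ℚ := (x.val : ℚ) / q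

/-- The sawtooth function of `x / q` for a residue class `x` modulo `q`. -/
noncomputable def residueSaw {q : ℕ} (x : ZMod q) : ℚ :=
  if x = 0 then 0 else residueFract x - 1 / 2

/-- The contribution of the modulus `q` to the formula for `numSol`, as a function of a
residue class. -/
noncomputable def periodicPart {q : ℕ} (h k : ZMod q) : ℚ :=
  (k.val : ℚ) / (2 * q) + (if k = 0 then 1 / 2 else 0)
    - ∑ i ∈ range k.val, residueSaw ((i : ZMod q) * h)

theorem saw_natCast_div {q : ℕ} (hq : 0 < q) (m : ℕ) :
    saw ((m : ℚ) / q) = residueSaw (m : ZMod q) := by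
  have hq' : (q : ℚ) ≠ 0 := by positivity
  have hdvd : (∃ z : ℤ, (z : ℚ) = (m : ℚ) / q) ↔ (m : ZMod q) = 0 := by
    rw [ZMod.natCast_eq_zero_iff]
    constructor
    · rintro ⟨z, hz⟩
      rw [eq_div_iff hq'] at hz
      have hz' : z * q = m := by exact_mod_cast hz
      exact Int.natCast_dvd_natCast.mp ⟨z, by rw [← hz', mul_comm]⟩
    · rintro ⟨z, rfl⟩
      exact ⟨z, by push_cast; field_simp⟩
  have hfract : Int.fract ((m : ℚ) / q) = residueFract (m : ZMod q) := by
    rw [residueFract, ZMod.val_natCast, Int.fract_div_natCast_eq_div_natCast_mod]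
  unfold saw residueSaw
  simp only [hdvd, hfract]

theorem sum_Icc_residueSaw_mul {q : ℕ} (h : ZMod q) (n : ℕ) :
    ∑ i ∈ Icc 1 n, residueSaw ((i : ZMod q) * h)
      = ∑ i ∈ range (n + 1), residueSaw ((i : ZMod q) * h) := by
  refine sum_subset (fun i hi => ?_) fun i hi hi' => ?_
  · simp only [mem_Icc, mem_range] at *
    omega
  · simp only [mem_Icc, mem_range] at *
    obtain rfl : i = 0 := by omega
    simp [residueSaw]

section ResidueFunctions

variable {q : ℕ} [NeZero q]

theorem sum_residue_eq_sum_range (F : ZMod q → ℚ) :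
    ∑ x, F x = ∑ i ∈ range q, F (i : ZMod q) := by
  refine sum_bij' (fun x _ => x.val) (fun i _ => (i : ZMod q)) ?_ ?_ ?_ ?_ ?_
  · intro x _
    exact mem_range.2 x.val_lt
  · simp
  · intro x _
    simp
  · intro i hi
    exact ZMod.val_cast_of_lt (mem_range.1 hi)
  · intro x _
    simp

theorem sum_residueFract : ∑ x : ZMod q, residueFract x = ((q : ℚ) - 1) / 2 := by
  have hq : (q : ℚ) ≠ 0 := NeZero.ne _
  have gauss : ∀ n : ℕ, ∑ i ∈ range n, (i : ℚ) = n * (n - 1) / 2 := by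
    intro n
    induction n with
    | zero => simp
    | succ n ih => rw [sum_range_succ, ih]; push_cast; ring
  rw [sum_residue_eq_sum_range, sum_congr rfl (g := fun i : ℕ => (i : ℚ) / q), ← sum_div, gauss]
  · field_simp
  · intro i hi
    rw [residueFract, ZMod.val_cast_of_lt (mem_range.1 hi)]

theorem residueFract_add_one (x : ZMod q) :
    residueFract (x + 1) = residueFract x + 1 / q - if x = -1 then 1 else 0 := by
  have hcast : x + 1 = ((x.val + 1 : ℕ) : ZMod q) := by simp
  split_ifs with h
  · subst h
    obtain ⟨p, rfl⟩ := Nat.exists_eq_succ_of_ne_zero (NeZero.ne q)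
    simp only [neg_add_cancel, residueFract, ZMod.val_zero, Nat.succ_eq_add_one, ZMod.val_neg_one]
    have : ((p + 1 : ℕ) : ℚ) ≠ 0 := by positivity
    push_cast at this ⊢
    field_simp
    ring
  · have hlt : x.val + 1 < q := by
      refine lt_of_le_of_ne x.val_lt fun he => h ?_
      rw [eq_neg_iff_add_eq_zero, hcast, he, ZMod.natCast_self]
    rw [residueFract, hcast, ZMod.val_cast_of_lt hlt, residueFract]
    push_cast
    ring

theorem residueFract_neg (x : ZMod q) :
    residueFract (-x) = if x = 0 then 0 else 1 - residueFract x := by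
  have hq : (q : ℚ) ≠ 0 := NeZero.ne _
  split_ifs with h
  · simp [h, residueFract]
  · have := x.val_lt
    rw [residueFract, ZMod.neg_val, if_neg h, Nat.cast_sub x.val_lt.le, residueFract]
    field_simp

theorem sum_residueSaw : ∑ x : ZMod q, residueSaw x = 0 := by
  have h : ∀ x : ZMod q, residueSaw x = residueFract x - 1 / 2 + if x = 0 then 1 / 2 else 0 := by
    intro x
    unfold residueSaw
    split_ifs with hx
    · simp [hx, residueFract]
    · ring
  simp only [h, sum_add_distrib, sum_sub_distrib, sum_residueFract]
  simp
  ring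

theorem sum_range_residueSaw_mul {h : ZMod q} (hh : IsUnit h) :
    ∑ i ∈ range q, residueSaw ((i : ZMod q) * h) = 0 := by
  rw [← sum_residue_eq_sum_range fun x => residueSaw (x * h), ← sum_residueSaw (q := q)]
  exact Equiv.sum_comp hh.unit.mulRight residueSaw

theorem periodicPart_natCast {h : ZMod q} (hh : IsUnit h) {k : ℕ} (hk : 1 ≤ k) (hkq : k ≤ q) :
    periodicPart h (k : ZMod q)
      = (k : ℚ) / (2 * q) - ∑ i ∈ Icc 1 (k - 1), residueSaw ((i : ZMod q) * h) := by
  have hsum : ∑ i ∈ Icc 1 (k - 1), residueSaw ((i : ZMod q) * h)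
      = ∑ i ∈ range k, residueSaw ((i : ZMod q) * h) := by
    obtain ⟨j, rfl⟩ := Nat.exists_eq_add_of_le' hk
    rw [Nat.add_sub_cancel, sum_Icc_residueSaw_mul]
  rw [hsum, periodicPart]
  rcases hkq.lt_or_eq with hlt | rfl
  · have hne : (k : ZMod q) ≠ 0 := by
      rw [Ne, ZMod.natCast_eq_zero_iff]
      exact Nat.not_dvd_of_pos_of_lt hk hlt
    rw [ZMod.val_cast_of_lt hlt, if_neg hne, add_zero]
  · rw [sum_range_residueSaw_mul hh]
    simp
    field_simp

theorem periodicPart_sub_periodicPart_add_one {h : ZMod q} (hh : IsUnit h) (k : ZMod q) :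
    periodicPart h k - periodicPart h (k + 1)
      = 1 / 2 - 1 / (2 * q) - residueFract (-(k * h)) := by
  have hkh : k * h = 0 ↔ k = 0 := hh.mul_left_eq_zero
  have hsucc : periodicPart h (k + 1) = ((k.val + 1 : ℕ) : ℚ) / (2 * q)
      - ∑ i ∈ range (k.val + 1), residueSaw ((i : ZMod q) * h) := by
    have := periodicPart_natCast hh (Nat.le_add_left 1 k.val) k.val_lt
    rw [Nat.cast_add, ZMod.natCast_zmod_val, Nat.cast_one] at this
    rw [this, Nat.add_sub_cancel, sum_Icc_residueSaw_mul]
  rw [hsucc, periodicPart, sum_range_succ, ZMod.natCast_zmod_val, residueFract_neg, residueSaw]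
  simp only [hkh]
  split_ifs <;> push_cast <;> ring

/-- Shifting the argument of `periodicPart h` by the inverse of `h` changes it in a way
analogous to a shift by one. -/
theorem periodicPart_sub_periodicPart_add_inv {h g : ZMod q} (hgh : g * h = 1) (k : ZMod q) :
    periodicPart h k - periodicPart h (k + g) = 1 / 2 - 1 / (2 * q) - residueFract (-k) := by
  have hq : (q : ℚ) ≠ 0 := NeZero.ne _
  have hh : IsUnit h := IsUnit.of_mul_eq_one g (by rw [mul_comm, hgh])
  set D : ZMod q → ℚ := fun k => periodicPart h k - periodicPart h (k + g)
    - (1 / 2 - 1 / (2 * q) - residueFract (-k)) with hD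
  have hstep : ∀ k, D (k + 1) = D k := by
    intro k
    have h1 := periodicPart_sub_periodicPart_add_one hh k
    have h2 := periodicPart_sub_periodicPart_add_one hh (k + g)
    have h3 := residueFract_add_one (-(k + 1))
    have h4 := residueFract_add_one (-((k + g) * h))
    have e3 : -(k + 1) + 1 = -k := by ring
    have e4 : -((k + g) * h) + 1 = -(k * h) := by linear_combination -hgh
    have hiff : -(k + 1) = -1 ↔ -((k + g) * h) = -1 := by
      rw [neg_inj, neg_inj, add_eq_right, add_mul, hgh, add_eq_right, hh.mul_left_eq_zero]
    rw [e3] at h3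
    rw [e4] at h4
    simp only [hiff] at h3
    simp only [hD]
    rw [add_right_comm k 1 g]
    linarith
  have hconst : ∀ k, D k = D 0 := by
    have : ∀ m : ℕ, D (m : ZMod q) = D 0 := by
      intro m
      induction m with
      | zero => simp
      | succ m ih => rw [Nat.cast_succ, hstep, ih]
    intro k
    rw [← this k.val, ZMod.natCast_zmod_val]
  have hsum : ∑ k, D k = 0 := by
    have e1 : ∑ k, periodicPart h (k + g) = ∑ k, periodicPart h k :=
      Equiv.sum_comp (Equiv.addRight g) (periodicPart h)
    have e2 : ∑ k : ZMod q, residueFract (-k) = ∑ k : ZMod q, residueFract k :=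
      Equiv.sum_comp (Equiv.neg (ZMod q)) residueFract
    simp only [hD, sum_sub_distrib, e1, e2, sum_residueFract]
    simp
    field_simp
    ring
  have hzero : D k = 0 := by
    rw [sum_congr rfl fun k _ => hconst k, sum_const, card_univ, ZMod.card, nsmul_eq_mul] at hsum
    rw [hconst k]
    exact (mul_eq_zero.1 hsum).resolve_left hq
  exact sub_eq_zero.1 hzero

end ResidueFunctions

/-- Popoviciu's formula for the number of nonnegative solutions of `a * x + c * z = m`. -/
theorem ncard_two_variables {a c : ℕ} (ha : 0 < a) (hc : 0 < c) (hca : Nat.Coprime c a) (m : ℕ) :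
    (({p : ℕ × ℕ | a * p.1 + c * p.2 = m}.ncard : ℕ) : ℚ)
      = (m : ℚ) / (a * c) + 1 - residueFract ((m : ZMod c) * (a : ZMod c)⁻¹)
        - residueFract ((m : ZMod a) * (c : ZMod a)⁻¹) := by
  have : NeZero a := ⟨ha.ne'⟩
  have : NeZero c := ⟨hc.ne'⟩
  set u := ((m : ZMod c) * (a : ZMod c)⁻¹).val with hu
  set v := ((m : ZMod a) * (c : ZMod a)⁻¹).val with hv
  have huc : u < c := ZMod.val_lt _
  have hva : v < a := ZMod.val_lt _
  have hcu : (c : ℤ) ∣ (m : ℤ) - a * u := by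
    rw [← ZMod.intCast_eq_intCast_iff_dvd_sub]
    push_cast
    rw [hu, ZMod.natCast_zmod_val, mul_left_comm, ZMod.coe_mul_inv_eq_one _ hca.symm, mul_one]
  have hav : (a : ℤ) ∣ (m : ℤ) - c * v := by
    rw [← ZMod.intCast_eq_intCast_iff_dvd_sub]
    push_cast
    rw [hv, ZMod.natCast_zmod_val, mul_left_comm, ZMod.coe_mul_inv_eq_one _ hca, mul_one]
  obtain ⟨t, ht⟩ : (a * c : ℤ) ∣ (m : ℤ) - a * u - c * v := by
    refine IsCoprime.mul_dvd (Nat.isCoprime_iff_coprime.2 hca.symm) ?_ ?_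
    · rw [sub_right_comm]
      exact dvd_sub hav (dvd_mul_right _ _)
    · exact dvd_sub hcu (dvd_mul_right _ _)
  have htpos : -1 ≤ t := by
    by_contra! hlt
    have h1 : a * (u + 1) ≤ a * c := Nat.mul_le_mul_left _ huc
    have h2 : c * (v + 1) ≤ c * a := Nat.mul_le_mul_left _ hva
    have h3 : (a * c : ℤ) * t ≤ (a * c : ℤ) * (-2) :=
      mul_le_mul_of_nonneg_left (by omega) (by positivity)
    zify at h1 h2 ha hc
    nlinarith
  obtain ⟨T, hT⟩ : ∃ T : ℕ, (T : ℤ) = t + 1 := ⟨(t + 1).toNat, by omega⟩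
  have hm : (m : ℤ) + a * c = a * u + c * v + a * c * T := by
    rw [hT]; linear_combination ht
  have hset : {p : ℕ × ℕ | a * p.1 + c * p.2 = m}
      = ((range T).image fun j => (u + c * j, v + a * (T - 1 - j)) : Finset (ℕ × ℕ)) := by
    ext ⟨x, z⟩
    simp only [Set.mem_ofPred_eq, coe_image, coe_range, Set.mem_image, Set.mem_Iio, Prod.mk.injEq]
    constructor
    · intro hxz
      zify at hxz
      obtain ⟨j, hj⟩ : (c : ℤ) ∣ (x : ℤ) - u := by
        refine (Nat.isCoprime_iff_coprime.2 hca).dvd_of_dvd_mul_left (y := (a : ℤ)) ?_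
        have : (a : ℤ) * (x - u) = (m - a * u) - c * z := by linear_combination hxz
        rw [this]
        exact dvd_sub hcu (dvd_mul_right _ _)
      have hj0 : 0 ≤ j := by
        by_contra! hlt
        zify at huc
        nlinarith
      lift j to ℕ using hj0
      have hz : (z : ℤ) = v + a * (T - 1 - j) := by
        have hc' : (c : ℤ) ≠ 0 := by positivity
        refine mul_left_cancel₀ hc' ?_
        linear_combination hxz - a * hj + hm
      have hjT : j < T := by
        by_contra! hle
        have : (a : ℤ) * (T - 1 - j) ≤ a * (-1) :=
          mul_le_mul_of_nonneg_left (by omega) (by positivity)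
        zify at hva
        linarith
      refine ⟨j, hjT, ?_, ?_⟩
      · zify; linarith
      · zify
        rw [hz, Nat.sub_sub, Nat.cast_sub (by omega)]
        push_cast; ring
    · rintro ⟨j, hj, rfl, rfl⟩
      zify
      rw [Nat.sub_sub, Nat.cast_sub (by omega)]
      push_cast
      linear_combination -hm
  have hcard : {p : ℕ × ℕ | a * p.1 + c * p.2 = m}.ncard = T := by
    rw [hset, Set.ncard_coe_finset, card_image_of_injective, card_range]
    intro i j hij
    simp only [Prod.mk.injEq, add_right_inj] at hij
    exact Nat.eq_of_mul_eq_mul_left hc hij.1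
  have hmq : (m : ℚ) + a * c = a * u + c * v + a * c * T := by exact_mod_cast hm
  rw [hcard, residueFract, residueFract, ← hu, ← hv]
  field_simp
  linear_combination -hmq

theorem finite_setOf_linear_eq {a b c : ℕ} (ha : 0 < a) (hb : 0 < b) (hc : 0 < c) (n : ℕ) :
    {p : ℕ × ℕ × ℕ | a * p.1 + b * p.2.1 + c * p.2.2 = n}.Finite := by
  refine (Set.finite_Iic ((n, n, n) : ℕ × ℕ × ℕ)).subset ?_
  rintro ⟨x, y, z⟩ h
  simp only [Set.mem_ofPred_eq] at h
  have h1 : x ≤ a * x := Nat.le_mul_of_pos_left _ ha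
  have h2 : y ≤ b * y := Nat.le_mul_of_pos_left _ hb
  have h3 : z ≤ c * z := Nat.le_mul_of_pos_left _ hc
  simp only [Set.mem_Iic, Prod.mk_le_mk]
  omega

theorem numSol_add {a b c : ℕ} (ha : 0 < a) (hb : 0 < b) (hc : 0 < c) (n : ℕ) :
    numSol a b c (n + b)
      = numSol a b c n + {p : ℕ × ℕ | a * p.1 + c * p.2 = n + b}.ncard := by
  set f : ℕ × ℕ × ℕ → ℕ × ℕ × ℕ := fun p => (p.1, p.2.1 + 1, p.2.2) with hf
  set g : ℕ × ℕ → ℕ × ℕ × ℕ := fun p => (p.1, 0, p.2) with hg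
  have hfinj : Function.Injective f := by
    rintro ⟨x, y, z⟩ ⟨x', y', z'⟩ h
    simpa [hf] using h
  have hginj : Function.Injective g := by
    rintro ⟨x, z⟩ ⟨x', z'⟩ h
    simpa [hg] using h
  have hunion : {p : ℕ × ℕ × ℕ | a * p.1 + b * p.2.1 + c * p.2.2 = n + b}
      = f '' {p : ℕ × ℕ × ℕ | a * p.1 + b * p.2.1 + c * p.2.2 = n}
        ∪ g '' {p : ℕ × ℕ | a * p.1 + c * p.2 = n + b} := by
    ext ⟨x, y, z⟩
    simp only [hf, hg, Set.mem_union, Set.mem_image, Set.mem_ofPred_eq, Prod.exists, Prod.mk.injEq]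
    constructor
    · intro h
      cases y with
      | zero => exact Or.inr ⟨x, z, by simpa using h, rfl, rfl, rfl⟩
      | succ y => exact Or.inl ⟨x, y, z, by rw [mul_add] at h; omega, rfl, rfl, rfl⟩
    · rintro (⟨x, y, z, h, rfl, rfl, rfl⟩ | ⟨x, z, h, rfl, rfl, rfl⟩)
      · rw [mul_add]; omega
      · simpa using h
  have hfin := finite_setOf_linear_eq ha hb hc (n + b)
  rw [hunion, Set.finite_union] at hfin
  rw [numSol, hunion, Set.ncard_union_eq ?_ hfin.1 hfin.2, Set.ncard_image_of_injective _ hfinj,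
    Set.ncard_image_of_injective _ hginj, numSol]
  rw [Set.disjoint_left]
  rintro _ ⟨p, _, rfl⟩ ⟨p', _, h⟩
  simp [hf, hg] at h

theorem numSol_rotate (a b c n : ℕ) : numSol b c a n = numSol a b c n := by
  have hinj : Function.Injective fun p : ℕ × ℕ × ℕ => (p.2.1, p.2.2, p.1) := by
    rintro ⟨x, y, z⟩ ⟨x', y', z'⟩ h
    simp only [Prod.mk.injEq] at h ⊢
    tauto
  rw [numSol, numSol,
    ← Set.ncard_image_of_injective {p | a * p.1 + b * p.2.1 + c * p.2.2 = n} hinj]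
  congr 1
  ext ⟨x, y, z⟩
  simp only [Set.mem_ofPred_eq, Set.mem_image, Prod.exists, Prod.mk.injEq]
  constructor
  · intro h
    exact ⟨z, x, y, by omega, rfl, rfl, rfl⟩
  · rintro ⟨x, y, z, h, rfl, rfl, rfl⟩
    omega

theorem numSol_zero {a b c : ℕ} (ha : 0 < a) (hb : 0 < b) (hc : 0 < c) : numSol a b c 0 = 1 := by
  rw [numSol, Set.ncard_eq_one]
  refine ⟨(0, 0, 0), ?_⟩
  ext ⟨x, y, z⟩
  simp [ha.ne', hb.ne', hc.ne', and_assoc]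

/-- The explicit quasi-polynomial that counts the solutions of `a * x + b * y + c * z = n`. -/
noncomputable def quasiPolynomial (a b c n : ℕ) : ℚ :=
  (n : ℚ) * (n + a + b + c) / (2 * a * b * c) - 1 / 2
    + periodicPart ((b : ZMod a) * (c : ZMod a)⁻¹) (-(n : ZMod a) * (b : ZMod a)⁻¹)
    + periodicPart ((c : ZMod b) * (a : ZMod b)⁻¹) (-(n : ZMod b) * (c : ZMod b)⁻¹)
    + periodicPart ((a : ZMod c) * (b : ZMod c)⁻¹) (-(n : ZMod c) * (a : ZMod c)⁻¹)

theorem quasiPolynomial_rotate (a b c n : ℕ) :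
    quasiPolynomial b c a n = quasiPolynomial a b c n := by
  unfold quasiPolynomial
  ring

theorem quasiPolynomial_zero (a b c : ℕ) : quasiPolynomial a b c 0 = 1 := by
  simp [quasiPolynomial, periodicPart]
  norm_num

theorem isUnit_natCast_mul_inv {q x y : ℕ} (hx : x.Coprime q) (hy : y.Coprime q) :
    IsUnit ((x : ZMod q) * (y : ZMod q)⁻¹) :=
  IsUnit.of_mul_eq_one ((y : ZMod q) * (x : ZMod q)⁻¹) <| by
    linear_combination (x : ZMod q) * (x : ZMod q)⁻¹ * ZMod.coe_mul_inv_eq_one y hy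
      + ZMod.coe_mul_inv_eq_one x hx

theorem numSol_sub_quasiPolynomial_add {a b c : ℕ} (ha : 0 < a) (hb : 0 < b) (hc : 0 < c)
    (hab : a.Coprime b) (hbc : b.Coprime c) (hca : c.Coprime a) (n : ℕ) :
    (numSol a b c (n + b) : ℚ) - quasiPolynomial a b c (n + b)
      = numSol a b c n - quasiPolynomial a b c n := by
  have : NeZero a := ⟨ha.ne'⟩
  have : NeZero b := ⟨hb.ne'⟩
  have : NeZero c := ⟨hc.ne'⟩
  have ebA := ZMod.coe_mul_inv_eq_one b hab.symm
  have eaC := ZMod.coe_mul_inv_eq_one a hca.symm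
  have ebC := ZMod.coe_mul_inv_eq_one b hbc
  have hA := periodicPart_sub_periodicPart_add_one
    (isUnit_natCast_mul_inv hab.symm hca) (-((n + b : ℕ) : ZMod a) * (b : ZMod a)⁻¹)
  have hC := periodicPart_sub_periodicPart_add_inv
    (g := (b : ZMod c) * (a : ZMod c)⁻¹) (h := (a : ZMod c) * (b : ZMod c)⁻¹)
    (by linear_combination (b : ZMod c) * (b : ZMod c)⁻¹ * eaC + ebC)
    (-((n + b : ℕ) : ZMod c) * (a : ZMod c)⁻¹)
  have eA : -((n + b : ℕ) : ZMod a) * (b : ZMod a)⁻¹ + 1 = -(n : ZMod a) * (b : ZMod a)⁻¹ := by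
    push_cast; linear_combination -ebA
  have eA' : -(-((n + b : ℕ) : ZMod a) * (b : ZMod a)⁻¹ * ((b : ZMod a) * (c : ZMod a)⁻¹))
      = ((n + b : ℕ) : ZMod a) * (c : ZMod a)⁻¹ := by
    linear_combination ((n + b : ℕ) : ZMod a) * (c : ZMod a)⁻¹ * ebA
  have eC : -((n + b : ℕ) : ZMod c) * (a : ZMod c)⁻¹ + (b : ZMod c) * (a : ZMod c)⁻¹
      = -(n : ZMod c) * (a : ZMod c)⁻¹ := by
    push_cast; ring
  have eC' : -(-((n + b : ℕ) : ZMod c) * (a : ZMod c)⁻¹)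
      = ((n + b : ℕ) : ZMod c) * (a : ZMod c)⁻¹ := by ring
  have eB : ((n + b : ℕ) : ZMod b) = n := by simp
  have hN := ncard_two_variables ha hc hca (n + b)
  rw [eA, eA'] at hA
  rw [eC, eC'] at hC
  have hpoly : ((n + b : ℕ) : ℚ) * ((n + b : ℕ) + a + b + c) / (2 * a * b * c)
      - (n : ℚ) * (n + a + b + c) / (2 * a * b * c)
      = ((n + b : ℕ) : ℚ) / (a * c) + 1 / (2 * a) + 1 / (2 * c) := by
    push_cast
    field_simp
    ring
  rw [numSol_add ha hb hc, Nat.cast_add (numSol a b c n), hN, quasiPolynomial, quasiPolynomial, eB]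
  linarith

theorem numSol_eq_quasiPolynomial {a b c : ℕ} (ha : 0 < a) (hb : 0 < b) (hc : 0 < c)
    (hab : a.Coprime b) (hbc : b.Coprime c) (hca : c.Coprime a) (n : ℕ) :
    (numSol a b c n : ℚ) = quasiPolynomial a b c n := by
  set E : ℕ → ℚ := fun n => numSol a b c n - quasiPolynomial a b c n with hE
  have hEb : ∀ k m, E (m + b * k) = E m := by
    intro k m
    induction k with
    | zero => simp
    | succ k ih =>
      rw [← ih, mul_add_one, ← add_assoc]
      exact numSol_sub_quasiPolynomial_add ha hb hc hab hbc hca _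
  have hEc : ∀ k m, E (m + c * k) = E m := by
    intro k m
    induction k with
    | zero => simp
    | succ k ih =>
      rw [← ih, mul_add_one, ← add_assoc]
      have := numSol_sub_quasiPolynomial_add hb hc ha hbc hca hab (m + c * k)
      simpa only [numSol_rotate, quasiPolynomial_rotate] using this
  have : NeZero b := ⟨hb.ne'⟩
  obtain ⟨y, x, hxy⟩ : ∃ y x : ℕ, n + c * y = b * x := by
    refine ⟨(-(n : ZMod b) * (c : ZMod b)⁻¹).val, ?_⟩
    change b ∣ _
    rw [← ZMod.natCast_eq_zero_iff]
    push_cast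
    rw [ZMod.natCast_zmod_val]
    linear_combination -(n : ZMod b) * ZMod.coe_mul_inv_eq_one c hbc.symm
  have hn : E n = 0 := by
    rw [← hEc y n, hxy, ← zero_add (b * x), hEb]
    simp [hE, numSol_zero ha hb hc, quasiPolynomial_zero]
  exact sub_eq_zero.1 hn

theorem periodicPart_eq_sub_sum_saw {q x y n k h : ℕ} (hq : 0 < q) (hx : x.Coprime q)
    (hy : y.Coprime q) (hk : 1 ≤ k ∧ k ≤ q ∧ (q : ℤ) ∣ (x : ℤ) * k + n)
    (hh : (q : ℤ) ∣ (y : ℤ) * h - x) :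
    periodicPart ((x : ZMod q) * (y : ZMod q)⁻¹) (-(n : ZMod q) * (x : ZMod q)⁻¹)
      = (k : ℚ) / (2 * q) - ∑ i ∈ Icc 1 (k - 1), saw ((i : ℚ) * h / q) := by
  have : NeZero q := ⟨hq.ne'⟩
  have hk' : (x : ZMod q) * k + n = 0 := by
    have := (ZMod.intCast_zmod_eq_zero_iff_dvd _ q).2 hk.2.2
    exact_mod_cast this
  have hh' : (y : ZMod q) * h - x = 0 := by
    have := (ZMod.intCast_zmod_eq_zero_iff_dvd _ q).2 hh
    exact_mod_cast this
  have ek : -(n : ZMod q) * (x : ZMod q)⁻¹ = k := by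
    linear_combination (k : ZMod q) * ZMod.coe_mul_inv_eq_one x hx - (x : ZMod q)⁻¹ * hk'
  have eh : (x : ZMod q) * (y : ZMod q)⁻¹ = h := by
    linear_combination (h : ZMod q) * ZMod.coe_mul_inv_eq_one y hy - (y : ZMod q)⁻¹ * hh'
  rw [ek, periodicPart_natCast (isUnit_natCast_mul_inv hx hy) hk.1 hk.2.1, eh]
  congr 1
  refine sum_congr rfl fun i _ => ?_
  rw [← Nat.cast_mul, ← Nat.cast_mul, saw_natCast_div hq]


theorem stmt_1 (a b c n b1 c1 c2 a2 a3 b3 : ℕ)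
    (ha : 0 < a) (hb : 0 < b) (hc : 0 < c) (hn : 0 < n)
    (hab : Nat.gcd a b = 1) (hbc : Nat.gcd b c = 1) (hca : Nat.gcd c a = 1)
    (hb1 : 1 ≤ b1 ∧ b1 ≤ a ∧ (a : ℤ) ∣ ((b : ℤ) * b1 + n))
    (hc1 : 1 ≤ c1 ∧ c1 ≤ a ∧ (a : ℤ) ∣ ((c : ℤ) * c1 - b))
    (hc2 : 1 ≤ c2 ∧ c2 ≤ b ∧ (b : ℤ) ∣ ((c : ℤ) * c2 + n))
    (ha2 : 1 ≤ a2 ∧ a2 ≤ b ∧ (b : ℤ) ∣ ((a : ℤ) * a2 - c))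
    (ha3 : 1 ≤ a3 ∧ a3 ≤ c ∧ (c : ℤ) ∣ ((a : ℤ) * a3 + n))
    (hb3 : 1 ≤ b3 ∧ b3 ≤ c ∧ (c : ℤ) ∣ ((b : ℤ) * b3 - a)) :
    (numSol a b c n : ℚ) =
      (n : ℚ) * ((n : ℚ) + a + b + c) / (2 * a * b * c) - 1 / 2
      + ((b1 : ℚ) / (2 * a) + (c2 : ℚ) / (2 * b) + (a3 : ℚ) / (2 * c))
      - ∑ i ∈ Finset.Icc 1 (b1 - 1), saw ((i : ℚ) * c1 / a)
      - ∑ i ∈ Finset.Icc 1 (c2 - 1), saw ((i : ℚ) * a2 / b)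
      - ∑ i ∈ Finset.Icc 1 (a3 - 1), saw ((i : ℚ) * b3 / c) := by
  rw [numSol_eq_quasiPolynomial ha hb hc hab hbc hca, quasiPolynomial,
    periodicPart_eq_sub_sum_saw ha (Nat.Coprime.symm hab) hca hb1 hc1.2.2,
    periodicPart_eq_sub_sum_saw hb (Nat.Coprime.symm hbc) hab hc2 ha2.2.2,
    periodicPart_eq_sub_sum_saw hc (Nat.Coprime.symm hca) hbc ha3 hb3.2.2]
  ring
end

section
/- Let a, b, c be positive integers with gcd(a,b) = gcd(b,c) = gcd(c,a) = 1, and set α = (a+b+c)/2 and β = 2abc. If t and k are nonnegative integers such that N(a,b,c;t) = k, then β(k−α) + α² < (t+α)² < β(k+α) + α². -/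
/-- A full period of an arithmetic progression in `ZMod m` with invertible step has the residues
`0, …, m - 1` in some order, so the deviations from the mean residue cancel. -/
lemma sum_period_val_deviation (m : ℕ) [NeZero m] (u v : ZMod m) (hv : IsUnit v) :
    ∑ j ∈ Finset.range m, (2 * ((u + v * (j : ZMod m)).val : ℤ) - (m - 1)) = 0 := by
  have hsum : ∀ f : ZMod m → ℤ, ∑ j ∈ Finset.range m, f (j : ZMod m) = ∑ x, f x := by
    intro f
    refine Finset.sum_bij (fun j _ => (j : ZMod m)) (fun _ _ => Finset.mem_univ _) ?_ ?_
      (fun _ _ => rfl)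
    · intro i hi j hj hij
      have h := congrArg ZMod.val hij
      rwa [ZMod.val_cast_of_lt (Finset.mem_range.mp hi),
        ZMod.val_cast_of_lt (Finset.mem_range.mp hj)] at h
    · intro x _
      exact ⟨x.val, Finset.mem_range.mpr (ZMod.val_lt x), ZMod.natCast_zmod_val x⟩
  obtain ⟨w, rfl⟩ := hv
  have hperm : ∑ x : ZMod m, (2 * ((u + w * x).val : ℤ) - (m - 1))
      = ∑ x : ZMod m, (2 * (x.val : ℤ) - (m - 1)) :=
    Equiv.sum_comp ((Units.mulLeft w).trans (Equiv.addLeft u))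
      (fun x : ZMod m => 2 * (x.val : ℤ) - (m - 1))
  rw [hsum (fun x => 2 * ((u + w * x).val : ℤ) - (m - 1)), hperm,
    ← hsum (fun x => 2 * (x.val : ℤ) - (m - 1))]
  have hval : ∀ j ∈ Finset.range m,
      2 * (((j : ZMod m)).val : ℤ) - (m - 1) = 2 * (j : ℤ) - (m - 1) := by
    intro j hj
    rw [ZMod.val_cast_of_lt (Finset.mem_range.mp hj)]
  rw [Finset.sum_congr rfl hval]
  have key : ∀ n : ℕ, ∑ j ∈ Finset.range n, (2 * (j : ℤ) - (m - 1)) = n * (n - m) := by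
    intro n
    induction n with
    | zero => simp
    | succ n ih => rw [Finset.sum_range_succ, ih]; push_cast; ring
  rw [key]; ring

lemma abs_sum_val_deviation_le (m : ℕ) [NeZero m] (v : ZMod m) (hv : IsUnit v) (n : ℕ) :
    ∀ u : ZMod m,
      |∑ j ∈ Finset.range n, (2 * ((u + v * (j : ZMod m)).val : ℤ) - (m - 1))| ≤
        ((m : ℤ) - 1) ^ 2 := by
  have hm : 0 < m := NeZero.pos m
  induction n using Nat.strong_induction_on with
  | _ n ih =>
    intro u
    rcases lt_or_ge n m with h | h
    · have hterm : ∀ j ∈ Finset.range n,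
          |2 * ((u + v * (j : ZMod m)).val : ℤ) - (m - 1)| ≤ (m : ℤ) - 1 := by
        intro j _
        have := ZMod.val_lt (u + v * (j : ZMod m))
        rw [abs_le]
        constructor <;> omega
      refine (Finset.abs_sum_le_sum_abs _ _).trans ((Finset.sum_le_sum hterm).trans ?_)
      rw [Finset.sum_const, Finset.card_range, nsmul_eq_mul, sq]
      gcongr <;> omega
    · obtain ⟨k, rfl⟩ := Nat.exists_eq_add_of_le h
      rw [Finset.sum_range_add, sum_period_val_deviation m u v hv, zero_add]
      convert ih k (by omega) u using 7
      simp

/-- The solutions of `a * x + b * y = n` are parametrised by `Finset.range q`, starting from the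
least residues `x₀`, `y₀`. -/
lemma mul_add_mul_eq_iff {a b n x₀ y₀ q : ℕ} (hab : Nat.Coprime a b) (hx : x₀ < b) (hy : y₀ < a)
    (hq : n + a * b = a * x₀ + b * y₀ + a * b * q) (x y : ℕ) :
    a * x + b * y = n ↔ ∃ i < q, x = x₀ + b * i ∧ y = y₀ + a * (q - 1 - i) := by
  constructor
  · intro h
    have hxm : x ≡ x₀ [MOD b] := by
      refine Nat.ModEq.cancel_left_of_coprime (c := a) hab.symm ?_
      rw [Nat.modEq_iff_dvd]
      refine ⟨(y : ℤ) + a - y₀ - a * q, ?_⟩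
      zify at h hq
      push_cast
      linear_combination -h - hq
    have hym : y ≡ y₀ [MOD a] := by
      refine Nat.ModEq.cancel_left_of_coprime (c := b) hab ?_
      rw [Nat.modEq_iff_dvd]
      refine ⟨(x : ℤ) + b - x₀ - b * q, ?_⟩
      zify at h hq
      push_cast
      linear_combination -h - hq
    have hx' : x = x₀ + b * (x / b) := by
      conv_lhs => rw [← Nat.mod_add_div x b, Nat.mod_eq_of_modEq hxm hx]
    have hy' : y = y₀ + a * (y / a) := by
      conv_lhs => rw [← Nat.mod_add_div y a, Nat.mod_eq_of_modEq hym hy]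
    generalize x / b = i at hx'
    generalize y / a = j at hy'
    have hij : i + j + 1 = q := by
      have hpos : 0 < a * b := Nat.mul_pos (by omega) (by omega)
      refine Nat.eq_of_mul_eq_mul_left hpos ?_
      subst hx' hy'
      linarith
    refine ⟨i, by omega, hx', ?_⟩
    rw [show q - 1 - i = j by omega]
    exact hy'
  · rintro ⟨i, hi, rfl, rfl⟩
    obtain ⟨j, rfl⟩ : ∃ j, q = i + j + 1 := ⟨q - 1 - i, by omega⟩
    rw [show i + j + 1 - 1 - i = j by omega]
    linarith

lemma exists_count_eq {a b n x₀ y₀ : ℕ} (hab : Nat.Coprime a b) (hx : x₀ < b) (hy : y₀ < a)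
    (hxn : a * x₀ ≡ n [MOD b]) (hyn : b * y₀ ≡ n [MOD a]) :
    ∃ q, n + a * b = a * x₀ + b * y₀ + a * b * q := by
  have h1 : (b : ℤ) ∣ n + a * b - a * x₀ - b * y₀ := by
    obtain ⟨d, hd⟩ := (Nat.modEq_iff_dvd.mp hxn)
    refine ⟨d + a - y₀, ?_⟩
    push_cast at hd
    linear_combination hd
  have h2 : (a : ℤ) ∣ n + a * b - a * x₀ - b * y₀ := by
    obtain ⟨d, hd⟩ := (Nat.modEq_iff_dvd.mp hyn)
    refine ⟨d + b - x₀, ?_⟩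
    push_cast at hd
    linear_combination hd
  obtain ⟨q, hq⟩ := (Nat.isCoprime_iff_coprime.mpr hab).mul_dvd h2 h1
  have hlow : -1 < q := by
    by_contra hcon
    have hx' : (x₀ : ℤ) + 1 ≤ b := by exact_mod_cast hx
    have hy' : (y₀ : ℤ) + 1 ≤ a := by exact_mod_cast hy
    have ha : (0 : ℤ) < a := by omega
    have hb : (0 : ℤ) < b := by omega
    have := mul_nonneg (mul_pos ha hb).le (show 0 ≤ -1 - q by omega)
    have := mul_le_mul_of_nonneg_left hx' ha.le
    have := mul_le_mul_of_nonneg_left hy' hb.le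
    nlinarith
  lift q to ℕ using by omega
  refine ⟨q, ?_⟩
  zify
  linear_combination hq

/-- Grouping the solutions by `z = Z - j`, where `t = r + c * Z`. -/
lemma numSol_eq_sum {a b c r Z : ℕ} (hb : 0 < b) (hr : r < c)
    (hab : Nat.Coprime a b) (x₀ y₀ q : ℕ → ℕ) (hx : ∀ j, x₀ j < b) (hy : ∀ j, y₀ j < a)
    (hq : ∀ j, r + c * j + a * b = a * x₀ j + b * y₀ j + a * b * q j) :
    numSol a b c (r + c * Z) = ∑ j ∈ Finset.range (Z + 1), q j := by
  classical
  let φ : (Σ _ : ℕ, ℕ) → ℕ × ℕ × ℕ :=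
    fun s => (x₀ s.1 + b * s.2, y₀ s.1 + a * (q s.1 - 1 - s.2), Z - s.1)
  let T := (Finset.range (Z + 1)).sigma fun j => Finset.range (q j)
  have hset : {p : ℕ × ℕ × ℕ | a * p.1 + b * p.2.1 + c * p.2.2 = r + c * Z} =
      φ '' (T : Set (Σ _ : ℕ, ℕ)) := by
    ext ⟨x, y, z⟩
    simp only [Set.mem_ofPred_eq, Set.mem_image, φ, T, Finset.mem_coe, Finset.mem_sigma,
      Finset.mem_range, Prod.mk.injEq]
    constructor
    · intro h
      have hz : z ≤ Z := by
        by_contra! hcon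
        have : c * (Z + 1) ≤ c * z := Nat.mul_le_mul_left c hcon
        nlinarith
      obtain ⟨j, rfl⟩ := Nat.exists_eq_add_of_le' hz
      obtain ⟨i, hi, h1, h2⟩ :=
        (mul_add_mul_eq_iff hab (hx j) (hy j) (hq j) x y).mp (by linarith)
      exact ⟨⟨j, i⟩, ⟨by lia, hi⟩, h1.symm, h2.symm, Nat.add_sub_cancel_left ..⟩
    · rintro ⟨⟨j, i⟩, ⟨hj, hi⟩, h1, h2, rfl⟩
      dsimp only at hj hi h1 h2 ⊢
      have h := (mul_add_mul_eq_iff hab (hx j) (hy j) (hq j) x y).mpr ⟨i, hi, h1.symm, h2.symm⟩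
      obtain ⟨k, rfl⟩ := Nat.exists_eq_add_of_le (show j ≤ Z by omega)
      rw [h]
      simp only [Nat.add_sub_cancel_left]
      ring
  have hinj : Set.InjOn φ (T : Set (Σ _ : ℕ, ℕ)) := by
    rintro ⟨j, i⟩ hs ⟨j', i'⟩ hs' h
    simp only [φ, T, Finset.mem_coe, Finset.mem_sigma, Finset.mem_range, Prod.mk.injEq] at hs hs' h
    obtain rfl : j = j' := by omega
    obtain rfl : i = i' := Nat.eq_of_mul_eq_mul_left hb (by omega)
    rfl
  rw [numSol, hset, hinj.ncard_image, Set.ncard_coe_finset, Finset.card_sigma]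
  simp

lemma mul_val_modEq {a b : ℕ} [NeZero b] (hab : Nat.Coprime a b) (n : ℕ) :
    a * ((n : ZMod b) * (a : ZMod b)⁻¹).val ≡ n [MOD b] := by
  rw [← ZMod.natCast_eq_natCast_iff]
  push_cast
  rw [ZMod.natCast_zmod_val, mul_left_comm, ZMod.coe_mul_inv_eq_one a hab, mul_one]

lemma abs_sum_residue_deviation_le {a b c : ℕ} [NeZero b] (hab : Nat.Coprime a b)
    (hcb : Nat.Coprime c b) (r n : ℕ) :
    |∑ j ∈ Finset.range n,
        (2 * ((((r + c * j : ℕ) : ZMod b) * (a : ZMod b)⁻¹).val : ℤ) - (b - 1))| ≤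
      ((b : ℤ) - 1) ^ 2 := by
  have hc : IsUnit (c : ZMod b) := (ZMod.isUnit_iff_coprime c b).mpr hcb
  have ha : IsUnit (a : ZMod b)⁻¹ :=
    .of_mul_eq_one_right (a : ZMod b) (ZMod.coe_mul_inv_eq_one a hab)
  convert abs_sum_val_deviation_le b (c * (a : ZMod b)⁻¹) (hc.mul ha) n
    ((r : ZMod b) * (a : ZMod b)⁻¹) using 7
  push_cast
  ring

theorem stmt_3 (a b c : ℕ)
    (ha : 0 < a) (hb : 0 < b) (hc : 0 < c)
    (hab : Nat.gcd a b = 1) (hbc : Nat.gcd b c = 1) (hca : Nat.gcd c a = 1)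
    (α β : ℚ) (hα : α = ((a : ℚ) + b + c) / 2) (hβ : β = 2 * a * b * c)
    (t k : ℕ) (hk : numSol a b c t = k) :
    β * ((k : ℚ) - α) + α ^ 2 < ((t : ℚ) + α) ^ 2 ∧
    ((t : ℚ) + α) ^ 2 < β * ((k : ℚ) + α) + α ^ 2 := by
  have : NeZero a := ⟨ha.ne'⟩
  have : NeZero b := ⟨hb.ne'⟩
  obtain ⟨r, Z, hr, rfl⟩ : ∃ r Z, r < c ∧ t = r + c * Z :=
    ⟨t % c, t / c, Nat.mod_lt _ hc, (Nat.mod_add_div t c).symm⟩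
  set x₀ : ℕ → ℕ := fun j => (((r + c * j : ℕ) : ZMod b) * (a : ZMod b)⁻¹).val
  set y₀ : ℕ → ℕ := fun j => (((r + c * j : ℕ) : ZMod a) * (b : ZMod a)⁻¹).val
  have hx : ∀ j, x₀ j < b := fun j => ZMod.val_lt _
  have hy : ∀ j, y₀ j < a := fun j => ZMod.val_lt _
  have hab' : Nat.Coprime a b := hab
  choose q hq using fun j => exists_count_eq hab (hx j) (hy j)
    (mul_val_modEq hab' (r + c * j)) (mul_val_modEq hab'.symm (r + c * j))
  rw [numSol_eq_sum hb hr hab x₀ y₀ q hx hy hq] at hk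
  have hG : |∑ j ∈ Finset.range (Z + 1), (2 * (x₀ j : ℤ) - (b - 1))| ≤ ((b : ℤ) - 1) ^ 2 :=
    abs_sum_residue_deviation_le hab' (Nat.Coprime.symm hbc) r (Z + 1)
  have hH : |∑ j ∈ Finset.range (Z + 1), (2 * (y₀ j : ℤ) - (a - 1))| ≤ ((a : ℤ) - 1) ^ 2 :=
    abs_sum_residue_deviation_le hab'.symm hca r (Z + 1)
  have hsum : ∀ n : ℕ, 2 * a * b * (∑ j ∈ Finset.range n, (q j : ℤ)) =
      n * (2 * r + c * (n - 1) + a + b)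
        - a * ∑ j ∈ Finset.range n, (2 * (x₀ j : ℤ) - (b - 1))
        - b * ∑ j ∈ Finset.range n, (2 * (y₀ j : ℤ) - (a - 1)) := by
    intro n
    induction n with
    | zero => simp
    | succ n ih =>
      have h := hq n
      zify at h
      simp only [Finset.sum_range_succ]
      push_cast
      linear_combination ih - 2 * h
  have hN := hsum (Z + 1)
  rw [← Nat.cast_sum, hk] at hN
  generalize ∑ j ∈ Finset.range (Z + 1), (2 * (x₀ j : ℤ) - (b - 1)) = G at hG hN
  generalize ∑ j ∈ Finset.range (Z + 1), (2 * (y₀ j : ℤ) - (a - 1)) = H at hH hN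
  have hN' : (2 * a * b * k : ℚ) = (Z + 1) * (2 * r + c * Z + a + b) - a * G - b * H := by
    have := congrArg (Int.cast : ℤ → ℚ) hN
    push_cast at this
    linear_combination this
  have hG' : |(G : ℚ)| ≤ ((b : ℚ) - 1) ^ 2 := by exact_mod_cast hG
  have hH' : |(H : ℚ)| ≤ ((a : ℚ) - 1) ^ 2 := by exact_mod_cast hH
  rw [abs_le] at hG' hH'
  have ha1 : (1 : ℚ) ≤ a := by exact_mod_cast ha
  have hb1 : (1 : ℚ) ≤ b := by exact_mod_cast hb
  have hc1 : (1 : ℚ) ≤ c := by exact_mod_cast hc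
  have hr0 : (0 : ℚ) ≤ r := by positivity
  have hrc : (r : ℚ) < c := by exact_mod_cast hr
  push_cast
  generalize (a : ℚ) = a at *
  generalize (b : ℚ) = b at *
  generalize (c : ℚ) = c at *
  generalize (r : ℚ) = r at *
  generalize (k : ℚ) = k at *
  generalize (Z : ℚ) = Z at *
  generalize (G : ℚ) = G at *
  generalize (H : ℚ) = H at *
  have hac : 0 < a * c := by positivity
  have hbc' : 0 < b * c := by positivity
  have hcount : β * k + α ^ 2 - (r + c * Z + α) ^ 2 =
      (c - r) * (r + a + b) - a * c * G - b * c * H := by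
    subst hα hβ
    linear_combination c * hN'
  have hβα : β * α = a * b * c * (a + b + c) := by subst hα hβ; ring
  have hG1 := mul_le_mul_of_nonneg_left hG'.1 hac.le
  have hG2 := mul_le_mul_of_nonneg_left hG'.2 hac.le
  have hH1 := mul_le_mul_of_nonneg_left hH'.1 hbc'.le
  have hH2 := mul_le_mul_of_nonneg_left hH'.2 hbc'.le
  have hsumprod : a + b ≤ 2 * (a * b) := by nlinarith
  have hab1 : 1 ≤ a * b := by nlinarith
  have hcc : c ^ 2 * 1 ≤ c ^ 2 * (a * b) := by gcongr
  have hdev : 0 ≤ (c - r) * (r + a + b) := mul_nonneg (by linarith) (by positivity)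
  constructor
  · nlinarith [sq_nonneg (c - 2 * r)]
  · nlinarith
end

section
/- Let a, b, c be positive integers with gcd(a,b) = gcd(b,c) = gcd(c,a) = 1. Set α = (a+b+c)/2, β = 2abc, M = ⌊((2αβ−1)² − 4α²)/(4β) + α⌋ + 1, γ_k = ⌊√(β(k+α) + α²) − α⌋ and δ_k = ⌊√(β(k−α) + α²) − α⌋. If k ≥ M and γ_k = δ_k, then there is no nonnegative integer t with N(a,b,c;t) = k. -/
open Finset in
/-- The sum of the elements of a finite set of naturals is at least that of an initial segment. -/
theorem card_mul_card_le_two_mul_sum_add_card (s : Finset ℕ) :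
    #s * #s ≤ 2 * ∑ x ∈ s, x + #s := by
  induction s using Finset.induction_on_max with
  | empty => simp
  | insert m s hm ih =>
    have hms : m ∉ s := fun h => lt_irrefl _ (hm m h)
    have hcard : #s ≤ m := by
      simpa using card_le_card (fun x hx => mem_range.2 (hm x hx) : s ⊆ range m)
    rw [card_insert_of_notMem hms, sum_insert hms]
    nlinarith

open Finset in
/-- Partial sums, over at most one period, of a sequence running through distinct residues. -/
theorem abs_sum_sub_mean_le_of_injOn {a r : ℕ} {f : ℕ → ℕ} (hlt : ∀ z, f z < a)
    (hinj : Set.InjOn f (range r)) :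
    |2 * ∑ z ∈ range r, (f z : ℤ) - r * (a - 1)| ≤ r * (a - r) := by
  have lower : ∀ g : ℕ → ℕ, Set.InjOn g (range r) →
      (r : ℤ) * r ≤ 2 * ∑ z ∈ range r, (g z : ℤ) + r := by
    intro g hg
    have h := card_mul_card_le_two_mul_sum_add_card ((range r).image g)
    rw [card_image_of_injOn hg, sum_image hg, card_range] at h
    exact_mod_cast h
  have h₁ := lower f hinj
  have h₂ := lower (fun z => a - 1 - f z) fun x hx y hy hxy => hinj hx hy <| by
    have := hlt x
    have := hlt y
    dsimp only at hxy
    omega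
  have h₃ : ∑ z ∈ range r, ((a - 1 - f z : ℕ) : ℤ)
      = r * (a - 1) - ∑ z ∈ range r, (f z : ℤ) := by
    have : ∀ z ∈ range r, ((a - 1 - f z : ℕ) : ℤ) = (a - 1) - f z := fun z _ => by
      have := hlt z
      omega
    rw [sum_congr rfl this, sum_sub_distrib]
    simp [mul_sub]
  rw [h₃] at h₂
  rw [abs_le]
  constructor <;> nlinarith

open Finset in
/-- Partial sums of a periodic sequence running through all residues stay close to the mean. -/
theorem abs_sum_sub_mean_le {a : ℕ} {f : ℕ → ℕ} (hlt : ∀ z, f z < a)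
    (hf : ∀ z w, f z = f w ↔ z ≡ w [MOD a]) (m : ℕ) :
    |8 * ∑ z ∈ range m, (f z : ℤ) - 4 * m * (a - 1)| ≤ a ^ 2 := by
  have hinj : ∀ r ≤ a, Set.InjOn f (range r) := fun r hr x hx y hy hxy => by
    simp only [coe_range, Set.mem_Iio] at hx hy
    exact Nat.ModEq.eq_of_lt_of_lt ((hf x y).1 hxy) (by omega) (by omega)
  induction m using Nat.strong_induction_on with
  | _ m ih =>
    have ha : 0 < a := (Nat.zero_le _).trans_lt (hlt 0)
    rcases le_total m a with hm | hm
    · have h := abs_le.1 (abs_sum_sub_mean_le_of_injOn hlt (hinj m hm))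
      rw [abs_le]
      constructor <;> nlinarith [sq_nonneg ((a : ℤ) - 2 * m)]
    · obtain ⟨n, rfl⟩ := Nat.exists_eq_add_of_le hm
      have h := abs_sum_sub_mean_le_of_injOn hlt (hinj a le_rfl)
      rw [sub_self, mul_zero, abs_nonpos_iff] at h
      have hper : ∀ z, f (a + z) = f z := fun z => (hf _ _).2 (by simp [Nat.ModEq])
      have hn := ih n (by omega)
      rw [sum_range_add]
      simp only [hper]
      convert hn using 2
      push_cast
      linarith

theorem Nat.Coprime.exists_lt_mul_modEq {a b : ℕ} (ha : 0 < a) (h : a.Coprime b) (n : ℕ) :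
    ∃ y < a, b * y ≡ n [MOD a] := by
  obtain ⟨y, hy⟩ := Nat.exists_mul_mod_eq_of_coprime n h.symm ha.ne'
  refine ⟨y % a, Nat.mod_lt _ ha, ?_⟩
  exact ((Nat.mod_modEq y a).mul_left b).trans hy.2

open Finset in
/-- Popoviciu's formula for the number of representations by two coprime generators. -/
theorem mul_card_antidiagonal_filter {a b n x₀ y₀ : ℕ} (ha : 0 < a) (hb : 0 < b)
    (hab : a.Coprime b) (hx : x₀ < b) (hy : y₀ < a) (hxn : a * x₀ ≡ n [MOD b])
    (hyn : b * y₀ ≡ n [MOD a]) :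
    a * b * #{p ∈ range (n + 1) ×ˢ range (n + 1) | a * p.1 + b * p.2 = n}
      + a * x₀ + b * y₀ = n + a * b := by
  have hmod : a * x₀ + b * y₀ ≡ n + a * b [MOD a * b] := by
    rw [← Nat.modEq_and_modEq_iff_modEq_mul hab]
    constructor
    · simpa [Nat.ModEq, Nat.add_mod] using hyn
    · simpa [Nat.ModEq, Nat.add_mod] using hxn
  obtain ⟨q, hq⟩ : ∃ q : ℕ, n + a * b = a * x₀ + b * y₀ + a * b * q := by
    obtain ⟨q, hq⟩ := (Nat.modEq_iff_dvd.1 hmod)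
    push_cast at hq
    have h₁ : (a : ℤ) * x₀ < a * b := by exact_mod_cast Nat.mul_lt_mul_of_pos_left hx ha
    have h₂ : (b : ℤ) * y₀ < a * b := by
      rw [mul_comm (a : ℤ)]; exact_mod_cast Nat.mul_lt_mul_of_pos_left hy hb
    have hpos : (0 : ℤ) < a * b := by positivity
    have h₃ : 0 ≤ q := by
      by_contra! h
      nlinarith
    lift q to ℕ using h₃
    exact ⟨q, by zify; linarith⟩
  suffices h : #{p ∈ range (n + 1) ×ˢ range (n + 1) | a * p.1 + b * p.2 = n} = q by
    rw [h, hq]; ring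
  rw [← card_range q]
  symm
  refine card_nbij (fun i => (x₀ + b * i, y₀ + a * (q - 1 - i))) ?_ ?_ ?_
  · intro i hi
    obtain ⟨j, rfl⟩ := Nat.exists_eq_add_of_lt (mem_range.1 hi)
    have hj : i + j + 1 - 1 - i = j := by omega
    have key : a * (x₀ + b * i) + b * (y₀ + a * j) = n := by nlinarith
    simp only [mem_coe, mem_filter, mem_product, mem_range, hj]
    refine ⟨⟨?_, ?_⟩, key⟩
    · nlinarith [Nat.zero_le (b * (y₀ + a * j)), Nat.le_mul_of_pos_left (x₀ + b * i) ha]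
    · nlinarith [Nat.zero_le (a * (x₀ + b * i)), Nat.le_mul_of_pos_left (y₀ + a * j) hb]
  · intro i _ j _ hij
    have := (Prod.ext_iff.1 hij).1
    simp only [add_right_inj] at this
    exact Nat.eq_of_mul_eq_mul_left hb this
  · rintro ⟨x, y⟩ hp
    simp only [mem_coe, mem_filter] at hp
    have hn := hp.2
    have hxx : x₀ ≡ x [MOD b] := by
      refine Nat.ModEq.cancel_left_of_coprime (c := a) hab.symm (hxn.trans ?_)
      rw [← hn]; simp [Nat.ModEq]
    have hyy : y₀ ≡ y [MOD a] := by
      refine Nat.ModEq.cancel_left_of_coprime (c := b) hab (hyn.trans ?_)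
      rw [← hn]; simp [Nat.ModEq]
    have hxle : x₀ ≤ x := by
      rw [← Nat.mod_eq_of_lt hx, hxx]; exact Nat.mod_le _ _
    have hyle : y₀ ≤ y := by
      rw [← Nat.mod_eq_of_lt hy, hyy]; exact Nat.mod_le _ _
    obtain ⟨i, hi⟩ := (Nat.modEq_iff_dvd' hxle).1 hxx
    obtain ⟨j, hj⟩ := (Nat.modEq_iff_dvd' hyle).1 hyy
    obtain rfl : x = x₀ + b * i := by omega
    obtain rfl : y = y₀ + a * j := by omega
    have hij : i + j + 1 = q := by
      apply Nat.eq_of_mul_eq_mul_left (Nat.mul_pos ha hb)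
      nlinarith
    refine ⟨i, by simp; omega, ?_⟩
    have : q - 1 - i = j := by omega
    simp [this]

open Finset in
/-- Counting solutions by the value of the third variable. -/
theorem numSol_eq_sum_s5 {a b c s m : ℕ} (ha : 0 < a) (hb : 0 < b) (hs : s < c) :
    numSol a b c (s + c * m) = ∑ w ∈ range (m + 1),
      #{p ∈ range (s + c * w + 1) ×ˢ range (s + c * w + 1) | a * p.1 + b * p.2 = s + c * w} := by
  have hc : 0 < c := by omega
  rw [← card_sigma, numSol, ← Set.ncard_coe_finset]
  symm
  refine Set.ncard_congr (fun q _ => (q.2.1, q.2.2, m - q.1)) ?_ ?_ ?_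
  · rintro ⟨w, x, y⟩ h
    simp only [mem_coe, mem_sigma, mem_filter, mem_range] at h
    obtain ⟨hw, -, h⟩ := h
    obtain ⟨v, rfl⟩ := Nat.exists_eq_add_of_le (Nat.lt_succ_iff.1 hw)
    simp only [Set.mem_ofPred_eq, h, Nat.add_sub_cancel_left]
    ring
  · rintro ⟨w, x, y⟩ ⟨w', x', y'⟩ h h' heq
    simp only [mem_coe, mem_sigma, mem_filter, mem_range] at h h'
    simp only [Prod.mk.injEq] at heq
    obtain ⟨rfl, rfl, hww⟩ := heq
    obtain rfl : w = w' := by omega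
    rfl
  · rintro ⟨x, y, z⟩ h
    simp only [Set.mem_ofPred_eq] at h
    have hz : z ≤ m := by
      by_contra! hlt
      have : c * (m + 1) ≤ c * z := Nat.mul_le_mul_left c hlt
      have : 0 ≤ a * x + b * y := Nat.zero_le _
      nlinarith
    obtain ⟨w, rfl⟩ := Nat.exists_eq_add_of_le' hz
    have key : a * x + b * y = s + c * w := by nlinarith
    refine ⟨⟨w, x, y⟩, ?_, by simp⟩
    simp only [mem_coe, mem_sigma, mem_filter, mem_range, mem_product]
    refine ⟨by omega, ⟨?_, ?_⟩, key⟩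
    · nlinarith [Nat.zero_le (b * y), Nat.le_mul_of_pos_left x ha]
    · nlinarith [Nat.zero_le (a * x), Nat.le_mul_of_pos_left y hb]

theorem Nat.Coprime.exists_residue_seq {a b c : ℕ} (ha : 0 < a) (hab : a.Coprime b)
    (hac : a.Coprime c) (s : ℕ) :
    ∃ f : ℕ → ℕ, (∀ z, f z < a) ∧ (∀ z, b * f z ≡ s + c * z [MOD a]) ∧
      ∀ z w, f z = f w ↔ z ≡ w [MOD a] := by
  choose f hlt hf using fun z => hab.exists_lt_mul_modEq ha (s + c * z)
  refine ⟨f, hlt, hf, fun z w => ⟨fun h => ?_, fun h => ?_⟩⟩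
  · have h₁ : s + c * z ≡ s + c * w [MOD a] := (hf z).symm.trans (h ▸ hf w)
    exact Nat.ModEq.cancel_left_of_coprime hac (Nat.ModEq.add_left_cancel' s h₁)
  · have h₁ : b * f z ≡ b * f w [MOD a] :=
      (hf z).trans (((h.mul_left c).add_left s).trans (hf w).symm)
    exact Nat.ModEq.eq_of_lt_of_lt (Nat.ModEq.cancel_left_of_coprime hab h₁) (hlt z) (hlt w)

open Finset in
/-- `numSol a b c t` differs from `t (t + a + b + c) / (2abc)` by less than `(a + b + c) / 2`. -/
theorem abs_numSol_sub_lt {a b c : ℕ} (ha : 0 < a) (hb : 0 < b) (hc : 0 < c)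
    (hab : a.Coprime b) (hbc : b.Coprime c) (hca : c.Coprime a) (t : ℕ) :
    |2 * (a * b * c * numSol a b c t : ℤ) - t * (t + a + b + c)| < a * b * c * (a + b + c) := by
  obtain ⟨s, m, hs, rfl⟩ : ∃ s m, s < c ∧ t = s + c * m :=
    ⟨t % c, t / c, Nat.mod_lt _ hc, (Nat.mod_add_div t c).symm⟩
  obtain ⟨y, hylt, hy, hyf⟩ := hab.exists_residue_seq ha hca.symm s
  obtain ⟨x, hxlt, hx, hxf⟩ := hab.symm.exists_residue_seq hb hbc s
  have hY := abs_le.1 (abs_sum_sub_mean_le hylt hyf (m + 1))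
  have hX := abs_le.1 (abs_sum_sub_mean_le hxlt hxf (m + 1))
  set Y := ∑ z ∈ range (m + 1), (y z : ℤ)
  set X := ∑ z ∈ range (m + 1), (x z : ℤ)
  have hN : 2 * ((a : ℤ) * b * numSol a b c (s + c * m)) + 2 * a * X + 2 * b * Y
      = (m + 1) * (2 * s + c * m + 2 * a * b) := by
    have h := sum_congr rfl fun w (_ : w ∈ range (m + 1)) =>
      mul_card_antidiagonal_filter ha hb hab (hxlt w) (hylt w) (hx w) (hy w)
    simp only [sum_add_distrib, ← mul_sum] at h
    rw [← numSol_eq_sum_s5 ha hb hs] at h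
    have hid := sum_range_id_mul_two (m + 1)
    simp only [sum_const, card_range, smul_eq_mul, Nat.add_sub_cancel] at h hid
    zify at h hid
    rw [← mul_sum (range (m + 1)) (fun w => (w : ℤ)) (c : ℤ)] at h
    linear_combination 2 * h + c * hid
  have ha' : (1 : ℤ) ≤ a := by exact_mod_cast ha
  have hb' : (1 : ℤ) ≤ b := by exact_mod_cast hb
  have hc' : (1 : ℤ) ≤ c := by exact_mod_cast hc
  have hs' : (s : ℤ) + 1 ≤ c := by exact_mod_cast hs
  have hs0 : (0 : ℤ) ≤ s := by positivity
  generalize numSol a b c (s + c * m) = N at *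
  push_cast at hX hY ⊢
  generalize (a : ℤ) = A at *
  generalize (b : ℤ) = B at *
  generalize (c : ℤ) = C at *
  generalize (s : ℤ) = S at *
  generalize (m : ℤ) = m at *
  generalize (N : ℤ) = N at *
  have key : 4 * (2 * (A * B * C * N) - (S + C * m) * (S + C * m + A + B + C))
      = 4 * (C - S) * (S + A + B) - A * C * (8 * X - 4 * (m + 1) * (B - 1))
        - B * C * (8 * Y - 4 * (m + 1) * (A - 1)) := by
    linear_combination 4 * C * hN
  have hAC : 0 ≤ A * C := by positivity
  have hBC : 0 ≤ B * C := by positivity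
  have hX₁ := mul_le_mul_of_nonneg_left hX.1 hAC
  have hX₂ := mul_le_mul_of_nonneg_left hX.2 hAC
  have hY₁ := mul_le_mul_of_nonneg_left hY.1 hBC
  have hY₂ := mul_le_mul_of_nonneg_left hY.2 hBC
  have hmain₀ : 0 ≤ (C - S) * (S + A + B) := mul_nonneg (by linarith) (by linarith)
  have hAB : 1 ≤ A * B := by nlinarith
  have hABC : 0 < A * B * C := by positivity
  have hABCC : 0 < A * B * C * C := by positivity
  have hABCAB : 0 < A * B * C * (A + B) := by positivity
  have hmain : 4 * ((C - S) * (S + A + B)) ≤ C ^ 2 + 4 * (C * (A + B)) := by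
    nlinarith [sq_nonneg (C - 2 * S), mul_nonneg hs0 (by linarith : 0 ≤ A + B)]
  have hCC : C ≤ A * B * C := le_mul_of_one_le_left (by linarith) hAB
  have h₁ : C ^ 2 ≤ A * B * C * C := by
    rw [sq]; exact mul_le_mul_of_nonneg_right hCC (by linarith)
  have h₂ : C * (A + B) ≤ A * B * C * (A + B) :=
    mul_le_mul_of_nonneg_right hCC (by linarith)
  have h₃ : C * (A + B) ≤ 2 * (A * B * C * C) := by
    have h₄ : A + B ≤ 2 * (A * B) := by nlinarith
    have h₅ : A * B * C ≤ A * B * C * C := le_mul_of_one_le_right hABC.le hc'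
    have h₆ := mul_le_mul_of_nonneg_left h₄ (by linarith : 0 ≤ C)
    linarith
  rw [abs_lt]
  constructor <;> linarith

theorem stmt_5 (a b c : ℕ)
    (ha : 0 < a) (hb : 0 < b) (hc : 0 < c)
    (hab : Nat.gcd a b = 1) (hbc : Nat.gcd b c = 1) (hca : Nat.gcd c a = 1)
    (α β : ℝ) (hα : α = ((a : ℝ) + b + c) / 2) (hβ : β = 2 * a * b * c)
    (M : ℤ) (hM : M = ⌊((2 * α * β - 1) ^ 2 - 4 * α ^ 2) / (4 * β) + α⌋ + 1)
    (k : ℕ)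
    (γ δ : ℤ)
    (hγ : γ = ⌊Real.sqrt (β * ((k : ℝ) + α) + α ^ 2) - α⌋)
    (hδ : δ = ⌊Real.sqrt (β * ((k : ℝ) - α) + α ^ 2) - α⌋)
    (hk : M ≤ (k : ℤ)) (hγδ : γ = δ) :
    ¬ ∃ t : ℕ, numSol a b c t = k := by
  rintro ⟨t, ht⟩
  have h := abs_lt.1 (abs_numSol_sub_lt ha hb hc hab hbc hca t)
  rw [ht] at h
  have h₁ : -((a : ℝ) * b * c * (a + b + c)) < 2 * (a * b * c * k) - t * (t + a + b + c) := by
    exact_mod_cast h.1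
  have h₂ : 2 * ((a : ℝ) * b * c * k) - t * (t + a + b + c) < a * b * c * (a + b + c) := by
    exact_mod_cast h.2
  have hα₀ : 0 < α := by rw [hα]; positivity
  have ht₀ : (0 : ℝ) ≤ t := by positivity
  have hupper : (t : ℤ) ≤ γ := by
    rw [hγ, Int.le_floor, le_sub_iff_add_le]
    apply Real.le_sqrt_of_sq_le
    rw [hα, hβ]
    push_cast
    nlinarith
  have hlower : δ < (t : ℤ) := by
    rw [hδ, Int.floor_lt, sub_lt_iff_lt_add, Real.sqrt_lt' (by push_cast; linarith)]
    rw [hα, hβ]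
    push_cast
    nlinarith
  omega
end
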